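/- In the multi-server secure aggregation model with heterogeneous security constraints, let u' ∈ [U], m ∈ [M], n ∈ [N] be such that (𝒮_m ∩ 𝒦_{{u'}}) ∩ 𝒯_n = ∅ and |(𝒮_m ∩ 𝒦_{{u'}}) ∪ 𝒦_{𝒰^{(m,n)}} ∪ 𝒯_n| = K−1, and let (u,v) be the unique user in 𝒦 ∖ ((𝒮_m ∩ 𝒦_{{u'}}) ∪ 𝒦_{𝒰^{(m,n)}} ∪ 𝒯_n). Then H(Z_{u,v} | {Z_{i,j}}_{(i,j)∈𝒯_n}) ≥ L. -/

import Mathlib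

open Finset

open scoped Classical

noncomputable section

/-- Probability that the random variable `X` takes the value `s`, under the weights `μ`. -/
def prb {Ω : Type} [Fintype Ω] (μ : Ω → ℝ) {α : Type} (X : Ω → α) (s : α) : ℝ :=
  ∑ ω ∈ Finset.univ.filter fun ω => X ω = s, μ ω

/-- Shannon entropy of `X` in `q`-ary units. -/
def ent (q : ℕ) {Ω : Type} [Fintype Ω] (μ : Ω → ℝ) {α : Type} [Fintype α] (X : Ω → α) : ℝ :=
  -∑ s : α, prb μ X s * Real.logb q (prb μ X s)

/-- Conditional entropy `H(X | Y)` in `q`-ary units. -/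
def condEnt (q : ℕ) {Ω : Type} [Fintype Ω] (μ : Ω → ℝ) {α β : Type} [Fintype α] [Fintype β]
    (X : Ω → α) (Y : Ω → β) : ℝ :=
  ent q μ (fun ω => (X ω, Y ω)) - ent q μ Y

/-- Conditional mutual information `I(X ; Y ∣ Z)` in `q`-ary units. -/
def mutInfo (q : ℕ) {Ω : Type} [Fintype Ω] (μ : Ω → ℝ) {α β γ : Type}
    [Fintype α] [Fintype β] [Fintype γ] (X : Ω → α) (Y : Ω → β) (Z : Ω → γ) : ℝ :=
  condEnt q μ X Z - condEnt q μ X fun ω => (Y ω, Z ω)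

/-- The joint random variable formed by the members of a family of random variables
indexed by a finset. -/
def restr {Ω ι α : Type} (Z : ι → Ω → α) (T : Finset ι) : Ω → { i // i ∈ T } → α :=
  fun ω i => Z i.1 ω

/-- The set of users `𝒦`: user `⟨u,v⟩` is the `v`-th user of server `u`. -/
abbrev Usr (U : ℕ) (V : Fin U → ℕ) : Type := Σ u : Fin U, Fin (V u)

/-- Total number of users, `K = ∑ u, V u`. -/
def Ktot (U : ℕ) (V : Fin U → ℕ) : ℕ := ∑ u, V u

/-- The users connected to server `u`, `𝒦_{{u}}`. -/
def Ksrv (U : ℕ) (V : Fin U → ℕ) (u : Fin U) : Finset (Usr U V) :=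
  Finset.univ.filter fun i => i.1 = u

/-- The users connected to a set of servers, `𝒦_𝒰`. -/
def KsrvSet (U : ℕ) (V : Fin U → ℕ) (A : Finset (Fin U)) : Finset (Usr U V) :=
  Finset.univ.filter fun i => i.1 ∈ A

/-- The set of servers `𝒰^{(m,n)}` associated with a security input set `Sm` and a
colluding set `Tn`. -/
def UServers (U : ℕ) (V : Fin U → ℕ) (Sm Tn : Finset (Usr U V)) : Finset (Fin U) :=
  Finset.univ.filter fun u =>
    (Sm ∩ Ksrv U V u).Nonempty ∧ ((Sm ∪ Tn) ∩ Ksrv U V u).card = V u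

/-- The set `(𝒮_m ∩ 𝒦_{{u}}) ∪ 𝒦_{𝒰^{(m,n)}} ∪ 𝒯_n`. -/
def BigB (U : ℕ) (V : Fin U → ℕ) (Sm Tn : Finset (Usr U V)) (u : Fin U) : Finset (Usr U V) :=
  (Sm ∩ Ksrv U V u) ∪ KsrvSet U V (UServers U V Sm Tn) ∪ Tn

/-- The implicit security input set `𝒮_I`. -/
def SImp (U : ℕ) (V : Fin U → ℕ) {M N : ℕ} (S : Fin M → Finset (Usr U V))
    (T : Fin N → Finset (Usr U V)) : Finset (Usr U V) :=
  Finset.univ.filter fun i =>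
    (∀ m, i ∉ S m) ∧
    ∃ u m n, (BigB U V (S m) (T n) u).card = Ktot U V - 1 ∧ i ∉ BigB U V (S m) (T n) u

/-- The total security input set `𝒮̄`. -/
def Sbar (U : ℕ) (V : Fin U → ℕ) {M N : ℕ} (S : Fin M → Finset (Usr U V))
    (T : Fin N → Finset (Usr U V)) : Finset (Usr U V) :=
  (Finset.univ.biUnion fun m => S m) ∪ SImp U V S T

/-- The set `𝒜_{u,m,n}`. -/
def Aset (U : ℕ) (V : Fin U → ℕ) {M N : ℕ} (S : Fin M → Finset (Usr U V))
    (T : Fin N → Finset (Usr U V)) (u : Fin U) (m : Fin M) (n : Fin N) : Finset (Usr U V) :=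
  BigB U V (S m) (T n) u ∩ Sbar U V S T

/-- `a* = max_{u,m,n} |𝒜_{u,m,n}|`. -/
def aStar (U : ℕ) (V : Fin U → ℕ) {M N : ℕ} (S : Fin M → Finset (Usr U V))
    (T : Fin N → Finset (Usr U V)) : ℕ :=
  Finset.univ.sup fun t : Fin U × Fin M × Fin N => (Aset U V S T t.1 t.2.1 t.2.2).card

/-- `|((𝒮_m ∩ 𝒦_{{u}}) ∪ 𝒯_n) ∩ 𝒮̄| + |𝒰^{(m,n)} ∖ {u}|`. -/
def eVal (U : ℕ) (V : Fin U → ℕ) {M N : ℕ} (S : Fin M → Finset (Usr U V))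
    (T : Fin N → Finset (Usr U V)) (u : Fin U) (m : Fin M) (n : Fin N) : ℕ :=
  (((S m ∩ Ksrv U V u) ∪ T n) ∩ Sbar U V S T).card + ((UServers U V (S m) (T n)).erase u).card

/-- `e* = max_{u,m,n} (|((𝒮_m ∩ 𝒦_{{u}}) ∪ 𝒯_n) ∩ 𝒮̄| + |𝒰^{(m,n)} ∖ {u}|)`. -/
def eStar (U : ℕ) (V : Fin U → ℕ) {M N : ℕ} (S : Fin M → Finset (Usr U V))
    (T : Fin N → Finset (Usr U V)) : ℕ :=
  Finset.univ.sup fun t : Fin U × Fin M × Fin N => eVal U V S T t.1 t.2.1 t.2.2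

/-- The set `𝒬_1`. -/
def Q1set (U : ℕ) (V : Fin U → ℕ) {M N : ℕ} (S : Fin M → Finset (Usr U V))
    (T : Fin N → Finset (Usr U V)) : Finset (Usr U V) :=
  (Finset.univ.filter fun t : Fin U × Fin M × Fin N =>
      (Aset U V S T t.1 t.2.1 t.2.2).card = (Sbar U V S T).card).biUnion
    fun t => BigB U V (S t.2.1) (T t.2.2) t.1

/-- The set `𝒬_2`. -/
def Q2set (U : ℕ) (V : Fin U → ℕ) {M N : ℕ} (S : Fin M → Finset (Usr U V))
    (T : Fin N → Finset (Usr U V)) : Finset (Usr U V) :=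
  (Finset.univ.filter fun t : Fin U × Fin M × Fin N =>
      eVal U V S T t.1 t.2.1 t.2.2 = eStar U V S T).biUnion
    fun t => BigB U V (S t.2.1) (T t.2.2) t.1

/-- The set `𝒬`. -/
def Qset (U : ℕ) (V : Fin U → ℕ) {M N : ℕ} (S : Fin M → Finset (Usr U V))
    (T : Fin N → Finset (Usr U V)) : Finset (Usr U V) :=
  if (Q1set U V S T).Nonempty then Q1set U V S T ∪ Q2set U V S T else ∅

/-- A secure-aggregation scheme: all structural, distributional, correctness and
security constraints of the multi-server secure aggregation model, with entropies in
`q`-ary units for `q = |F|`. -/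
def IsScheme (U : ℕ) (V : Fin U → ℕ) (M N : ℕ) (S : Fin M → Finset (Usr U V))
    (T : Fin N → Finset (Usr U V)) (F : Type) [Field F] [Fintype F]
    (Ω : Type) [Fintype Ω] (μ : Ω → ℝ) (L LX LY LZ LSig : ℕ)
    (W : Usr U V → Ω → Fin L → F) (Z : Usr U V → Ω → Fin LZ → F)
    (X : Usr U V → Ω → Fin LX → F) (Y : Fin U → Ω → Fin LY → F)
    (ZS : Ω → Fin LSig → F) : Prop :=
  let q := Fintype.card F
  (1 ≤ L) ∧
  (∀ ω, 0 ≤ μ ω) ∧ (∑ ω, μ ω = 1) ∧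
  -- each input consists of `L` i.i.d. uniform `q`-ary symbols
  (∀ i, ent q μ (W i) = L) ∧
  -- the inputs are mutually independent of each other and of all keys
  (ent q μ (fun ω => (restr W Finset.univ ω, restr Z Finset.univ ω)) =
    ent q μ (restr Z Finset.univ) + ∑ i, ent q μ (W i)) ∧
  -- the source key consists of `LSig` i.i.d. uniform `q`-ary symbols
  (ent q μ ZS = LSig) ∧
  -- the individual keys are deterministic functions of the source key
  (condEnt q μ (restr Z Finset.univ) ZS = 0) ∧
  -- each user message is a deterministic function of its input and key
  (∀ i, condEnt q μ (X i) (fun ω => (W i ω, Z i ω)) = 0) ∧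
  -- each server message is a deterministic function of its received messages
  (∀ u, condEnt q μ (Y u) (restr X (Ksrv U V u)) = 0) ∧
  -- correctness
  (∀ k, condEnt q μ (fun ω => ∑ i, W i ω)
    (fun ω => (restr Y (Finset.univ.erase k) ω, restr X (Ksrv U V k) ω)) = 0) ∧
  -- security
  (∀ k m n, mutInfo q μ
    (fun ω => (restr Y (Finset.univ.erase k) ω, restr X (Ksrv U V k) ω))
    (restr W (S m))
    (fun ω => (∑ i, W i ω, restr W (T n) ω, restr Z (T n) ω)) = 0)

/-- A rate tuple `(R_X, R_Y, R_{Z_Σ})` is achievable. -/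
def Achievable (U : ℕ) (V : Fin U → ℕ) (M N : ℕ) (S : Fin M → Finset (Usr U V))
    (T : Fin N → Finset (Usr U V)) (R : ℝ × ℝ × ℝ) : Prop :=
  ∃ (F : Type) (iF : Field F) (iFt : Fintype F) (Ω : Type) (iΩ : Fintype Ω)
    (μ : Ω → ℝ) (L LX LY LZ LSig : ℕ)
    (W : Usr U V → Ω → Fin L → F) (Z : Usr U V → Ω → Fin LZ → F)
    (X : Usr U V → Ω → Fin LX → F) (Y : Fin U → Ω → Fin LY → F)
    (ZS : Ω → Fin LSig → F),
    R.1 = (LX : ℝ) / (L : ℝ) ∧ R.2.1 = (LY : ℝ) / (L : ℝ) ∧ R.2.2 = (LSig : ℝ) / (L : ℝ) ∧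
    @IsScheme U V M N S T F iF iFt Ω iΩ μ L LX LY LZ LSig W Z X Y ZS

end

section Entropy

variable {Ω : Type} [Fintype Ω] {μ : Ω → ℝ}

/-- `X` is almost surely a function of `Y`: on the support of `μ`, the value of `Y` determines
the value of `X`. -/
def Determines {Ω : Type} (μ : Ω → ℝ) {α β : Type} (Y : Ω → β) (X : Ω → α) : Prop :=
  ∀ ω ω', 0 < μ ω → 0 < μ ω' → Y ω = Y ω' → X ω = X ω'

lemma prb_eq_sum_ite {α : Type} (X : Ω → α) (s : α) :
    prb μ X s = ∑ ω, if X ω = s then μ ω else 0 := by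
  rw [prb, Finset.sum_filter]

lemma prb_nonneg (hμ : ∀ ω, 0 ≤ μ ω) {α : Type} (X : Ω → α) (s : α) : 0 ≤ prb μ X s :=
  Finset.sum_nonneg fun ω _ => hμ ω

lemma le_prb (hμ : ∀ ω, 0 ≤ μ ω) {α : Type} (X : Ω → α) (ω : Ω) : μ ω ≤ prb μ X (X ω) :=
  Finset.single_le_sum (f := μ) (fun ω _ => hμ ω) (by simp)

lemma sum_prb_mul {α : Type} [Fintype α] (X : Ω → α) (f : α → ℝ) :
    ∑ s, prb μ X s * f s = ∑ ω, μ ω * f (X ω) := by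
  rw [← Finset.sum_fiberwise Finset.univ X]
  refine Finset.sum_congr rfl fun s _ => ?_
  rw [prb, Finset.sum_mul]
  exact Finset.sum_congr rfl fun ω hω => by rw [(Finset.mem_filter.1 hω).2]

lemma sum_prb {α : Type} [Fintype α] (X : Ω → α) : ∑ s, prb μ X s = ∑ ω, μ ω := by
  simpa using sum_prb_mul (μ := μ) X fun _ => 1

lemma sum_prb_pair {α β : Type} [Fintype α] (X : Ω → α) (Z : Ω → β) (z : β) :
    ∑ x, prb μ (fun ω => (X ω, Z ω)) (x, z) = prb μ Z z := by
  simp only [prb_eq_sum_ite]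
  rw [Finset.sum_comm]
  refine Finset.sum_congr rfl fun ω _ => ?_
  by_cases h : Z ω = z <;> simp [h]

lemma ent_eq_sum (q : ℕ) {α : Type} [Fintype α] (X : Ω → α) :
    ent q μ X = -∑ ω, μ ω * Real.logb q (prb μ X (X ω)) := by
  rw [ent, sum_prb_mul X fun s => Real.logb q (prb μ X s)]

lemma Determines.prb_le (hμ : ∀ ω, 0 ≤ μ ω) {α β : Type} {Y : Ω → β} {X : Ω → α}
    (h : Determines μ Y X) {ω : Ω} (hω : 0 < μ ω) : prb μ Y (Y ω) ≤ prb μ X (X ω) := by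
  simp only [prb_eq_sum_ite]
  refine Finset.sum_le_sum fun ω' _ => ?_
  rcases (hμ ω').eq_or_lt with h0 | h0
  · simp [← h0]
  · by_cases hY : Y ω' = Y ω
    · simp [hY, h ω' ω h0 hω hY]
    · rw [if_neg hY]
      split_ifs <;> simp [h0.le]

lemma Determines.ent_le (hμ : ∀ ω, 0 ≤ μ ω) {q : ℕ} (hq : 1 < q) {α β : Type} [Fintype α]
    [Fintype β] {Y : Ω → β} {X : Ω → α} (h : Determines μ Y X) : ent q μ X ≤ ent q μ Y := by
  rw [ent_eq_sum, ent_eq_sum, neg_le_neg_iff]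
  refine Finset.sum_le_sum fun ω _ => ?_
  rcases (hμ ω).eq_or_lt with h0 | h0
  · simp [← h0]
  · exact mul_le_mul_of_nonneg_left (Real.logb_le_logb_of_le (by exact_mod_cast hq)
      (h0.trans_le (le_prb hμ Y ω)) (h.prb_le hμ h0)) h0.le

lemma determines_of_condEnt_eq_zero (hμ : ∀ ω, 0 ≤ μ ω) {q : ℕ} (hq : 1 < q) {α β : Type}
    [Fintype α] [Fintype β] {X : Ω → α} {Y : Ω → β} (h : condEnt q μ X Y = 0) :
    Determines μ Y X := by
  have hq' : (1 : ℝ) < q := by exact_mod_cast hq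
  have hdet : Determines μ (fun ω => (X ω, Y ω)) Y := fun _ _ _ _ e => (Prod.ext_iff.1 e).2
  rw [condEnt, ent_eq_sum, ent_eq_sum, sub_eq_zero, neg_inj] at h
  have hterm := (Finset.sum_eq_sum_iff_of_le fun ω _ => by
    rcases (hμ ω).eq_or_lt with h0 | h0
    · simp [← h0]
    · exact mul_le_mul_of_nonneg_left (Real.logb_le_logb_of_le hq'
        (h0.trans_le (le_prb hμ _ ω)) (hdet.prb_le hμ h0)) h0.le).1 h
  intro ω ω' h0 h0' hY
  by_contra hX
  have hlog := mul_left_cancel₀ h0.ne' (hterm ω (Finset.mem_univ _))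
  have heq := Real.logb_injOn_pos hq' (h0.trans_le (le_prb hμ (fun ω => (X ω, Y ω)) ω))
    (h0.trans_le (le_prb hμ Y ω)) hlog
  refine heq.not_lt ?_
  simp only [prb_eq_sum_ite]
  refine Finset.sum_lt_sum (fun ω'' _ => ?_) ⟨ω', Finset.mem_univ _, ?_⟩
  · by_cases h1 : Y ω'' = Y ω
    · by_cases h2 : X ω'' = X ω <;> simp [h1, h2, hμ]
    · simp [h1]
  · simp [hY, Ne.symm hX, h0']

lemma ent_submodular_triple (hμ : ∀ ω, 0 ≤ μ ω) (h1 : ∑ ω, μ ω = 1) {q : ℕ} (hq : 1 < q)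
    {α β γ : Type} [Fintype α] [Fintype β] [Fintype γ] (X : Ω → α) (Y : Ω → β) (Z : Ω → γ) :
    ent q μ (fun ω => (X ω, Y ω, Z ω)) + ent q μ Z ≤
      ent q μ (fun ω => (X ω, Z ω)) + ent q μ (fun ω => (Y ω, Z ω)) := by
  have hlogq : 0 < Real.log q := Real.log_pos (by exact_mod_cast hq)
  set a := prb μ fun ω => (X ω, Z ω) with ha
  set b := prb μ fun ω => (Y ω, Z ω) with hb
  set c := prb μ Z with hc
  set d := prb μ fun ω => (X ω, Y ω, Z ω) with hd
  have ha0 : ∀ s, 0 ≤ a s := prb_nonneg hμ _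
  have hb0 : ∀ s, 0 ≤ b s := prb_nonneg hμ _
  have hc0 : ∀ s, 0 ≤ c s := prb_nonneg hμ _
  have hd0 : ∀ s, 0 ≤ d s := prb_nonneg hμ _
  let r : α × β × γ → ℝ := fun s => a (s.1, s.2.2) * b (s.2.1, s.2.2) / (d s * c s.2.2)
  have hr : ∑ ω, μ ω * r (X ω, Y ω, Z ω) ≤ 1 := by
    rw [← sum_prb_mul (fun ω => (X ω, Y ω, Z ω)) r]
    calc ∑ s, d s * r s
        ≤ ∑ s : α × β × γ, a (s.1, s.2.2) * b (s.2.1, s.2.2) / c s.2.2 := by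
          refine Finset.sum_le_sum fun s _ => ?_
          rcases (hd0 s).eq_or_lt with h0 | h0
          · rw [← h0, zero_mul]
            exact div_nonneg (mul_nonneg (ha0 _) (hb0 _)) (hc0 _)
          · refine le_of_eq ?_
            simp only [r]
            rw [mul_div_assoc', mul_div_mul_left _ _ h0.ne']
      _ = ∑ z, c z := by
          rw [Fintype.sum_prod_type_right, Fintype.sum_prod_type_right]
          refine Finset.sum_congr rfl fun z _ => ?_
          simp_rw [← Finset.sum_div, ← Finset.sum_mul, ← Finset.mul_sum]
          rw [ha, hb, sum_prb_pair, sum_prb_pair]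
          exact mul_self_div_self _
      _ = 1 := by rw [hc, sum_prb, h1]
  have hlog : ∑ ω, μ ω * (Real.logb q (a (X ω, Z ω)) + Real.logb q (b (Y ω, Z ω)) -
      Real.logb q (d (X ω, Y ω, Z ω)) - Real.logb q (c (Z ω))) ≤
      ∑ ω, (μ ω * r (X ω, Y ω, Z ω) - μ ω) / Real.log q := by
    refine Finset.sum_le_sum fun ω _ => ?_
    rcases (hμ ω).eq_or_lt with h0 | h0
    · simp [← h0]
    · have hA := h0.trans_le (le_prb hμ (fun ω => (X ω, Z ω)) ω)
      have hB := h0.trans_le (le_prb hμ (fun ω => (Y ω, Z ω)) ω)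
      have hC := h0.trans_le (le_prb hμ Z ω)
      have hD := h0.trans_le (le_prb hμ (fun ω => (X ω, Y ω, Z ω)) ω)
      have hratio := Real.log_le_sub_one_of_pos (div_pos (mul_pos hA hB) (mul_pos hD hC))
      rw [Real.log_div (mul_pos hA hB).ne' (mul_pos hD hC).ne', Real.log_mul hA.ne' hB.ne',
        Real.log_mul hD.ne' hC.ne'] at hratio
      simp only [Real.logb]
      rw [← add_div, ← sub_div, ← sub_div, mul_div_assoc']
      refine div_le_div_of_nonneg_right ?_ hlogq.le
      rw [← mul_sub_one]
      refine mul_le_mul_of_nonneg_left ?_ h0.le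
      simp only [r]
      linarith
  rw [← Finset.sum_div, Finset.sum_sub_distrib, h1] at hlog
  have hle := hlog.trans (div_nonpos_of_nonpos_of_nonneg (sub_nonpos.2 hr) hlogq.le)
  simp only [mul_sub, mul_add, Finset.sum_sub_distrib, Finset.sum_add_distrib] at hle
  simp only [ent_eq_sum]
  linarith

/-- Submodularity of entropy, up to almost sure functional dependence. -/
lemma ent_submodular (hμ : ∀ ω, 0 ≤ μ ω) (h1 : ∑ ω, μ ω = 1) {q : ℕ} (hq : 1 < q)
    {α β γ δ : Type} [Fintype α] [Fintype β] [Fintype γ] [Fintype δ]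
    {A : Ω → α} {B : Ω → β} {D : Ω → γ} {E : Ω → δ} (hA : Determines μ A D)
    (hB : Determines μ B D) (hE : Determines μ (fun ω => (A ω, B ω)) E) :
    ent q μ E + ent q μ D ≤ ent q μ A + ent q μ B := by
  have hsub := ent_submodular_triple hμ h1 hq A B D
  have hE' : ent q μ E ≤ ent q μ (fun ω => (A ω, B ω, D ω)) :=
    Determines.ent_le hμ hq fun ω ω' h h' e => by
      simp only [Prod.mk.injEq] at e
      exact hE ω ω' h h' (Prod.ext e.1 e.2.1)
  have hA' : ent q μ (fun ω => (A ω, D ω)) ≤ ent q μ A :=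
    Determines.ent_le hμ hq fun ω ω' h h' e => Prod.ext e (hA ω ω' h h' e)
  have hB' : ent q μ (fun ω => (B ω, D ω)) ≤ ent q μ B :=
    Determines.ent_le hμ hq fun ω ω' h h' e => Prod.ext e (hB ω ω' h h' e)
  linarith

lemma ent_of_subsingleton (h1 : ∑ ω, μ ω = 1) (q : ℕ) {α : Type} [Fintype α] [Subsingleton α]
    (X : Ω → α) : ent q μ X = 0 := by
  have h : ∀ s, prb μ X s = 1 := fun s => by
    rw [prb_eq_sum_ite, ← h1]
    exact Finset.sum_congr rfl fun ω _ => if_pos (Subsingleton.elim _ _)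
  simp [ent, h]

lemma ent_pair_le (hμ : ∀ ω, 0 ≤ μ ω) (h1 : ∑ ω, μ ω = 1) {q : ℕ} (hq : 1 < q)
    {α β : Type} [Fintype α] [Fintype β] (X : Ω → α) (Y : Ω → β) :
    ent q μ (fun ω => (X ω, Y ω)) ≤ ent q μ X + ent q μ Y := by
  have h := ent_submodular hμ h1 hq (A := X) (B := Y) (D := fun _ => ())
    (E := fun ω => (X ω, Y ω)) (fun _ _ _ _ _ => rfl) (fun _ _ _ _ _ => rfl)
    (fun _ _ _ _ e => e)
  rwa [ent_of_subsingleton h1 q fun _ => (), add_zero] at h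

lemma ent_restr_le (hμ : ∀ ω, 0 ≤ μ ω) (h1 : ∑ ω, μ ω = 1) {q : ℕ} (hq : 1 < q)
    {ι α : Type} [DecidableEq ι] [Fintype α] (X : ι → Ω → α) (T : Finset ι) :
    ent q μ (restr X T) ≤ ∑ i ∈ T, ent q μ (X i) := by
  induction T using Finset.induction_on with
  | empty =>
    have : IsEmpty {i : ι // i ∈ (∅ : Finset ι)} := ⟨fun i => Finset.notMem_empty _ i.2⟩
    rw [ent_of_subsingleton h1, Finset.sum_empty]
  | insert i T hi ih =>
    rw [Finset.sum_insert hi]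
    refine le_trans ?_ ((ent_pair_le hμ h1 hq (X i) (restr X T)).trans (by linarith))
    refine Determines.ent_le hμ hq fun ω ω' _ _ e => funext fun ⟨j, hj⟩ => ?_
    simp only [Prod.mk.injEq] at e
    rcases Finset.mem_insert.1 hj with rfl | hj
    · exact e.1
    · exact congrFun e.2 ⟨j, hj⟩

lemma ent_le_logb_card (hμ : ∀ ω, 0 ≤ μ ω) (h1 : ∑ ω, μ ω = 1) {q : ℕ} (hq : 1 < q)
    {α : Type} [Fintype α] (X : Ω → α) : ent q μ X ≤ Real.logb q (Fintype.card α) := by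
  have hlogq : 0 < Real.log q := Real.log_pos (by exact_mod_cast hq)
  obtain ⟨ω₀, -, -⟩ := Finset.exists_ne_zero_of_sum_ne_zero (h1.trans_ne one_ne_zero)
  have hcard : (0 : ℝ) < Fintype.card α :=
    Nat.cast_pos.2 (Fintype.card_pos_iff.2 ⟨X ω₀⟩)
  have hterm : ∀ s, prb μ X s * (-Real.log (Fintype.card α) - Real.log (prb μ X s)) ≤
      1 / (Fintype.card α : ℝ) - prb μ X s := fun s => by
    rcases (prb_nonneg hμ X s).eq_or_lt with h0 | h0
    · rw [← h0]
      simp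
    · have h := Real.log_le_sub_one_of_pos
        (one_div_pos.2 (mul_pos hcard h0))
      rw [one_div, Real.log_inv, Real.log_mul hcard.ne' h0.ne'] at h
      have h' := mul_le_mul_of_nonneg_left h h0.le
      have e : prb μ X s * ((Fintype.card α * prb μ X s)⁻¹ - 1) =
          1 / (Fintype.card α : ℝ) - prb μ X s := by
        field_simp
      rw [e] at h'
      linarith
  have hsum := Finset.sum_le_sum fun s (_ : s ∈ Finset.univ) => hterm s
  simp only [mul_sub, Finset.sum_sub_distrib, ← Finset.sum_mul, sum_prb, h1] at hsum
  simp only [Finset.sum_const, Finset.card_univ, nsmul_eq_mul, mul_one_div_cancel hcard.ne',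
    one_mul, sub_self] at hsum
  simp only [ent, Real.logb, mul_div_assoc', ← Finset.sum_div, ← neg_div]
  refine div_le_div_of_nonneg_right ?_ hlogq.le
  linarith

lemma ent_vector_le (hμ : ∀ ω, 0 ≤ μ ω) (h1 : ∑ ω, μ ω = 1) {F : Type} [Fintype F]
    (hF : 1 < Fintype.card F) {n : ℕ} (X : Ω → Fin n → F) :
    ent (Fintype.card F) μ X ≤ n := by
  have h := ent_le_logb_card hμ h1 hF X
  rwa [Fintype.card_fun, Fintype.card_fin, Nat.cast_pow, Real.logb_pow,
    Real.logb_self_eq_one (by exact_mod_cast hF), mul_one] at h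

end Entropy

lemma apply_eq_of_sum_eq {Ω ι A : Type} [Fintype ι] [AddCommGroup A] (W : ι → Ω → A) {i : ι}
    {ω ω' : Ω} (hne : ∀ j, j ≠ i → W j ω = W j ω') (hsum : ∑ j, W j ω = ∑ j, W j ω') :
    W i ω = W i ω' := by
  rw [Fintype.sum_eq_add_sum_compl i, Fintype.sum_eq_add_sum_compl i,
    Finset.sum_congr rfl fun j hj => hne j (by simpa using hj)] at hsum
  exact add_right_cancel hsum

lemma mem_or_mem_of_mem_bigB {U : ℕ} {V : Fin U → ℕ} {Sm Tn : Finset (Usr U V)} {u : Fin U}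
    {i : Usr U V} (hi : i ∈ BigB U V Sm Tn u) : i ∈ Sm ∨ i ∈ Tn := by
  simp only [BigB, Finset.mem_union, Finset.mem_inter] at hi
  rcases hi with (hi | hi) | hi
  · exact Or.inl hi.1
  · simp only [KsrvSet, UServers, Finset.mem_filter, Finset.mem_univ, true_and] at hi
    have hcard : (Ksrv U V i.1).card = V i.1 := by
      have h : Ksrv U V i.1 = Finset.univ.map (Function.Embedding.sigmaMk i.1) := by
        ext ⟨a, b⟩
        simp only [Ksrv, Finset.mem_filter, Finset.mem_univ, true_and, Finset.mem_map,
          Function.Embedding.sigmaMk_apply]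
        constructor
        · rintro rfl
          exact ⟨b, rfl⟩
        · rintro ⟨c, hc⟩
          exact (congrArg Sigma.fst hc).symm
      rw [h, Finset.card_map, Finset.card_univ, Fintype.card_fin]
    have heq := Finset.eq_of_subset_of_card_le
      (Finset.inter_subset_right (s₁ := Sm ∪ Tn) (s₂ := Ksrv U V i.1))
      (by rw [hcard]; exact hi.2.ge)
    have hmem : i ∈ (Sm ∪ Tn) ∩ Ksrv U V i.1 := by
      rw [heq]
      simp [Ksrv]
    exact Finset.mem_union.1 (Finset.mem_inter.1 hmem).1
  · exact Or.inr hi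

theorem stmt8_corollary1
    (U : ℕ) (hU : 3 ≤ U) (V : Fin U → ℕ) (hV : ∀ u, 1 ≤ V u)
    (M N : ℕ) (S : Fin M → Finset (Usr U V)) (T : Fin N → Finset (Usr U V))
    (hSmono : ∀ (m : Fin M) (A : Finset (Usr U V)), A ⊆ S m → ∃ m', S m' = A)
    (hTmono : ∀ (n : Fin N) (A : Finset (Usr U V)), A ⊆ T n → ∃ n', T n' = A)
    (hSne : (Finset.univ.biUnion fun m => S m).Nonempty)
    (hTcard : ∀ n, (T n).card ≤ Ktot U V - 2)
    (F : Type) [Field F] [Fintype F] (Ω : Type) [Fintype Ω] (μ : Ω → ℝ)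
    (L LX LY LZ LSig : ℕ)
    (W : Usr U V → Ω → Fin L → F) (Z : Usr U V → Ω → Fin LZ → F)
    (X : Usr U V → Ω → Fin LX → F) (Y : Fin U → Ω → Fin LY → F)
    (ZS : Ω → Fin LSig → F)
    (hScheme : IsScheme U V M N S T F Ω μ L LX LY LZ LSig W Z X Y ZS)
    (u' : Fin U) (m : Fin M) (n : Fin N)
    (hdisj : (S m ∩ Ksrv U V u') ∩ T n = ∅)
    (hcard : (BigB U V (S m) (T n) u').card = Ktot U V - 1)
    (i0 : Usr U V)
    (hi0 : Finset.univ \ BigB U V (S m) (T n) u' = {i0}) :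
    (L : ℝ) ≤ condEnt (Fintype.card F) μ (Z i0) (restr Z (T n)) := by
  obtain ⟨-, hμ, h1, hWent, hindep, -, -, hX, hY, hcorrect, hsec⟩ := hScheme
  have hq : 1 < Fintype.card F := Fintype.one_lt_card
  set q := Fintype.card F
  have hXdet := fun i => determines_of_condEnt_eq_zero hμ hq (hX i)
  have hYdet := fun u => determines_of_condEnt_eq_zero hμ hq (hY u)
  have hsumdet := determines_of_condEnt_eq_zero hμ hq (hcorrect i0.1)
  have hi0B : i0 ∉ BigB U V (S m) (T n) u' :=
    (Finset.mem_sdiff.1 (hi0 ▸ Finset.mem_singleton_self i0)).2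
  have hi0T : i0 ∉ T n := fun h => hi0B (Finset.mem_union_right _ h)
  have hcover : ∀ j, j ≠ i0 → j ∈ S m ∨ j ∈ T n := fun j hj => by
    refine mem_or_mem_of_mem_bigB (u := u') (by_contra fun h => hj ?_)
    rw [← Finset.mem_singleton, ← hi0]
    exact Finset.mem_sdiff.2 ⟨Finset.mem_univ _, h⟩
  obtain ⟨j0, hj0, hj0T⟩ : ∃ j0, j0 ≠ i0 ∧ j0 ∉ T n := by
    by_contra! h
    have hsub : Finset.univ.erase i0 ⊆ T n := fun j hj => h j (Finset.ne_of_mem_erase hj)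
    have hle := Finset.card_le_card hsub
    have hK : Fintype.card (Usr U V) = Ktot U V := by simp [Ktot, Usr]
    have hUK : U ≤ Ktot U V := by
      simpa [Ktot] using Finset.sum_le_sum fun u (_ : u ∈ Finset.univ) => hV u
    rw [Finset.card_erase_of_mem (Finset.mem_univ _), Finset.card_univ, hK] at hle
    have := hTcard n
    omega
  let others (i : Usr U V) : Finset (Usr U V) := Finset.univ.erase i
  let full : Ω → _ := fun ω => (restr W Finset.univ ω, restr Z Finset.univ ω)
  let G (i : Usr U V) : Ω → _ := fun ω => (restr W (others i) ω, restr Z Finset.univ ω)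
  have hG : ∀ i, ent q μ (G i) + L ≤ ent q μ full := fun i => by
    have hpair := ent_pair_le hμ h1 hq (restr W (others i)) (restr Z Finset.univ)
    have hW := ent_restr_le hμ h1 hq W (others i)
    have hsplit := Finset.sum_erase_add Finset.univ (fun i => ent q μ (W i)) (Finset.mem_univ i)
    have hWi := hWent i
    have hothers : ∑ j ∈ others i, ent q μ (W j) + L = ∑ j, ent q μ (W j) := by
      rw [← hsplit, hWi]
    have hfull : ent q μ full = ent q μ (restr Z Finset.univ) + ∑ i, ent q μ (W i) := hindep
    have hpair' : ent q μ (G i) ≤ _ := hpair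
    linarith
  let view : Ω → _ := fun ω =>
    (restr Y (Finset.univ.erase i0.1) ω, restr X (Ksrv U V i0.1) ω)
  let WS : Ω → _ := restr W (S m)
  let C' : Ω → _ := fun ω => (restr W (T n) ω, restr Z (T n) ω)
  let C : Ω → _ := fun ω => (∑ i, W i ω, restr W (T n) ω, restr Z (T n) ω)
  let R : Ω → _ := fun ω => (restr W (others i0) ω, restr Z (others i0) ω)
  have hothers : ∀ {i j : Usr U V}, j ≠ i → j ∈ others i := fun h =>
    Finset.mem_erase.2 ⟨h, Finset.mem_univ _⟩
  have hinputR : L + ent q μ R ≤ ent q μ (fun ω => (W i0 ω, R ω)) := by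
    have h := ent_submodular hμ h1 hq (A := fun ω => (W i0 ω, R ω)) (B := G i0) (D := R)
      (E := full) (fun _ _ _ _ e => (Prod.ext_iff.1 e).2)
      (fun ω ω' _ _ e => by
        simp only [G, Prod.mk.injEq] at e
        exact Prod.ext e.1 (funext fun j => congrFun e.2 ⟨j.1, Finset.mem_univ _⟩))
      (fun ω ω' _ _ e => by
        simp only [G, R, Prod.mk.injEq] at e
        refine Prod.ext (funext fun j => ?_) e.2.2
        by_cases hj : j.1 = i0
        · simpa only [full, restr, hj] using e.1.1
        · exact congrFun e.2.1 ⟨j.1, hothers hj⟩)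
    linarith [hG i0]
  have hmessage : L + ent q μ C' ≤ ent q μ (fun ω => (X i0 ω, C' ω)) := by
    have h := ent_submodular hμ h1 hq (A := fun ω => (X i0 ω, C' ω)) (B := R) (D := C')
      (E := fun ω => (W i0 ω, R ω)) (fun _ _ _ _ e => (Prod.ext_iff.1 e).2)
      (fun ω ω' _ _ e => by
        simp only [R, Prod.mk.injEq] at e
        have hT : ∀ j ∈ T n, j ∈ others i0 := fun j hj =>
          hothers fun h => hi0T (h ▸ hj)
        exact Prod.ext (funext fun j => congrFun e.1 ⟨j.1, hT _ j.2⟩)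
          (funext fun j => congrFun e.2 ⟨j.1, hT _ j.2⟩))
      (fun ω ω' hω hω' e => by
        simp only [R, Prod.mk.injEq] at e
        refine Prod.ext ?_ (Prod.ext e.2.1 e.2.2)
        have hXall : ∀ j, X j ω = X j ω' := fun j => by
          by_cases hj : j = i0
          · subst hj
            exact e.1.1
          · exact hXdet j ω ω' hω hω' (Prod.ext (congrFun e.2.1 ⟨j, hothers hj⟩)
              (congrFun e.2.2 ⟨j, hothers hj⟩))
        refine apply_eq_of_sum_eq W (fun j hj => congrFun e.2.1 ⟨j, hothers hj⟩)
          (hsumdet ω ω' hω hω' (Prod.ext (funext fun k => ?_) (funext fun j => hXall j)))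
        exact hYdet k.1 ω ω' hω hω' (funext fun j => hXall j))
    linarith
  have hCle : ent q μ C ≤ L + ent q μ C' := by
    have h := ent_pair_le hμ h1 hq (fun ω => ∑ i, W i ω) C'
    have hs := ent_vector_le hμ h1 hq (fun ω => ∑ i, W i ω)
    have h' : ent q μ C ≤ _ := h
    linarith
  have hmessageC : L + ent q μ (fun ω => (X i0 ω, C' ω)) ≤ ent q μ (fun ω => (X i0 ω, C ω)) := by
    have h := ent_submodular hμ h1 hq (A := fun ω => (X i0 ω, C ω)) (B := G j0)
      (D := fun ω => (X i0 ω, C' ω)) (E := full)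
      (fun ω ω' _ _ e => by
        simp only [C, Prod.mk.injEq] at e
        exact Prod.ext e.1 (Prod.ext e.2.2.1 e.2.2.2))
      (fun ω ω' hω hω' e => by
        simp only [G, Prod.mk.injEq] at e
        refine Prod.ext (hXdet i0 ω ω' hω hω' (Prod.ext (congrFun e.1 ⟨i0, hothers hj0.symm⟩)
          (congrFun e.2 ⟨i0, Finset.mem_univ _⟩))) (Prod.ext (funext fun j => ?_)
          (funext fun j => congrFun e.2 ⟨j.1, Finset.mem_univ _⟩))
        exact congrFun e.1 ⟨j.1, hothers fun h => hj0T (h ▸ j.2)⟩)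
      (fun ω ω' _ _ e => by
        simp only [G, C, Prod.mk.injEq] at e
        have hne : ∀ j, j ≠ j0 → W j ω = W j ω' := fun j hj =>
          congrFun e.2.1 ⟨j, hothers hj⟩
        refine Prod.ext (funext fun j => ?_) e.2.2
        by_cases hj : j.1 = j0
        · simp only [full, restr, hj]
          exact apply_eq_of_sum_eq W hne e.1.2.1
        · exact hne j.1 hj)
    linarith [hG j0]
  have hsecure : ent q μ (fun ω => (X i0 ω, C ω)) - ent q μ C ≤
      ent q μ (fun ω => (X i0 ω, WS ω, C ω)) - ent q μ (fun ω => (WS ω, C ω)) := by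
    have h := ent_submodular hμ h1 hq (A := fun ω => (view ω, C ω))
      (B := fun ω => (X i0 ω, WS ω, C ω)) (D := fun ω => (X i0 ω, C ω))
      (E := fun ω => (view ω, WS ω, C ω))
      (fun ω ω' _ _ e => by
        simp only [view, Prod.mk.injEq] at e
        exact Prod.ext (congrFun e.1.2 ⟨i0, by simp [Ksrv]⟩) e.2)
      (fun ω ω' _ _ e => by
        simp only [Prod.mk.injEq] at e
        exact Prod.ext e.1 e.2.2)
      (fun ω ω' _ _ e => by
        simp only [Prod.mk.injEq] at e
        exact Prod.ext e.1.1 (Prod.ext e.2.2.1 e.2.2.2))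
    have hs : ent q μ (fun ω => (view ω, C ω)) - ent q μ C -
        (ent q μ (fun ω => (view ω, WS ω, C ω)) - ent q μ (fun ω => (WS ω, C ω))) = 0 :=
      hsec i0.1 m n
    linarith
  have hkey : ent q μ (fun ω => (X i0 ω, WS ω, C ω)) + ent q μ (restr Z (T n)) ≤
      ent q μ (fun ω => (WS ω, C ω)) + ent q μ (fun ω => (Z i0 ω, restr Z (T n) ω)) :=
    ent_submodular hμ h1 hq
      (fun ω ω' _ _ e => by
        simp only [C, Prod.mk.injEq] at e
        exact e.2.2.2)
      (fun _ _ _ _ e => (Prod.ext_iff.1 e).2)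
      (fun ω ω' hω hω' e => by
        simp only [C, WS, Prod.mk.injEq] at e
        have hW : W i0 ω = W i0 ω' := by
          refine apply_eq_of_sum_eq W (fun j hj => ?_) e.1.2.1
          rcases hcover j hj with h | h
          · exact congrFun e.1.1 ⟨j, h⟩
          · exact congrFun e.1.2.2.1 ⟨j, h⟩
        refine Prod.ext (hXdet i0 ω ω' hω hω' (Prod.ext hW e.2.1)) (Prod.ext e.1.1 ?_)
        exact Prod.ext e.1.2.1 (Prod.ext e.1.2.2.1 e.1.2.2.2))
  rw [condEnt]
  linarith
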